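/- Let K be an algebraically closed field of characteristic 0. If the symbolic Rees algebra R_s(𝔭_K(5,103,169)) is Noetherian, then there exists a nonzero element g2 ∈ [𝔭_K(5,103,169)^{(59)}]_{17407} such that f, g2 is an S-regular sequence, where f is the negative curve spanning [𝔭_K(5,103,169)^{(7)}]_{2065} (note (2065/7)·(17407/59) = 5·103·169). In particular, [𝔭_K(5,103,169)^{(59)}]_{17407} ≠ 0. -/

import Mathlib

open MvPolynomial

noncomputable section

/-- The weight function assigning degrees `a, b, c` to the variables `x, y, z`. -/
def wt (a b c : ℕ) : Fin 3 → ℕ := ![a, b, c]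

/-- The `K`-algebra map `K[x,y,z] → K[T]`, `x ↦ T^a`, `y ↦ T^b`, `z ↦ T^c`. -/
def toPoly (K : Type*) [CommRing K] (a b c : ℕ) :
    MvPolynomial (Fin 3) K →ₐ[K] Polynomial K :=
  aeval ![Polynomial.X ^ a, Polynomial.X ^ b, Polynomial.X ^ c]

/-- The space monomial prime `𝔭_K(a,b,c)`. -/
def pIdeal (K : Type*) [CommRing K] (a b c : ℕ) : Ideal (MvPolynomial (Fin 3) K) :=
  RingHom.ker (toPoly K a b c)

instance pIdeal_isPrime (K : Type*) [Field K] (a b c : ℕ) : (pIdeal K a b c).IsPrime :=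
  RingHom.ker_isPrime _

/-- The `n`-th symbolic power `Q^{(n)} = Q^n A_Q ∩ A` of a prime ideal. -/
def symbPow {A : Type*} [CommRing A] (Q : Ideal A) [Q.IsPrime] (n : ℕ) : Ideal A :=
  Ideal.comap (algebraMap A (Localization.AtPrime Q))
    (Ideal.map (algebraMap A (Localization.AtPrime Q)) (Q ^ n))

/-- The symbolic Rees algebra `A[Qt, Q^{(2)}t^2, …] ⊆ A[t]`. -/
def symbolicRees {A : Type*} [CommRing A] (Q : Ideal A) [Q.IsPrime] :
    Subalgebra A (Polynomial A) :=
  Algebra.adjoin A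
    (⋃ n : ℕ, (fun p => Polynomial.C p * Polynomial.X ^ n) '' ((symbPow Q n : Ideal A) : Set A))

/-- The degree-`d` homogeneous component `[J]_d` of an ideal `J ⊆ K[x,y,z]`,
as a `K`-subspace. -/
def gpiece (K : Type*) [CommRing K] (a b c : ℕ) (J : Ideal (MvPolynomial (Fin 3) K))
    (d : ℕ) : Submodule K (MvPolynomial (Fin 3) K) :=
  (Submodule.restrictScalars K J) ⊓ (weightedHomogeneousSubmodule K (wt a b c) d)

end

/-! ### Symbolic powers -/

theorem mem_symbPow_iff {A : Type*} [CommRing A] (Q : Ideal A) [Q.IsPrime] (n : ℕ) (g : A) :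
    g ∈ symbPow Q n ↔ ∃ s ∉ Q, s * g ∈ Q ^ n := by
  rw [symbPow, Ideal.mem_comap,
    IsLocalization.algebraMap_mem_map_algebraMap_iff Q.primeCompl]
  rfl

theorem mul_mem_symbPow {A : Type*} [CommRing A] {Q : Ideal A} [Q.IsPrime] {m n : ℕ} {a b : A}
    (ha : a ∈ symbPow Q m) (hb : b ∈ symbPow Q n) : a * b ∈ symbPow Q (m + n) := by
  rw [mem_symbPow_iff] at *
  obtain ⟨s, hs, hsa⟩ := ha
  obtain ⟨t, ht, htb⟩ := hb
  refine ⟨s * t, fun h => (‹Q.IsPrime›.mem_or_mem h).elim hs ht, ?_⟩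
  rw [pow_add, mul_mul_mul_comm]
  exact Ideal.mul_mem_mul hsa htb

theorem mem_symbPow_zero {A : Type*} [CommRing A] (Q : Ideal A) [Q.IsPrime] (g : A) :
    g ∈ symbPow Q 0 := by
  simp [symbPow, Ideal.map_top]

/-- A ring map to a domain pulling a principal prime `(π)` back to `Q` sends the `r`-th symbolic
power of `Q` into `(π ^ r)`. -/
theorem pow_dvd_of_mem_symbPow {A B : Type*} [CommRing A] [CommRing B] [IsDomain B]
    (Q : Ideal A) [Q.IsPrime] (ψ : A →+* B) {π : B} (hπ : Prime π)
    (hQ : ∀ q, q ∈ Q ↔ π ∣ ψ q) {r : ℕ} {g : A} (hg : g ∈ symbPow Q r) : π ^ r ∣ ψ g := by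
  obtain ⟨s, hs, hsg⟩ := (mem_symbPow_iff Q r g).1 hg
  have hle : Q ≤ (Ideal.span {π}).comap ψ := fun q hq =>
    Ideal.mem_comap.2 (Ideal.mem_span_singleton.2 ((hQ q).1 hq))
  have h1 : ψ (s * g) ∈ Ideal.span {π} ^ r :=
    (Ideal.pow_right_mono hle r |>.trans (Ideal.le_comap_pow ψ r)) hsg
  rw [Ideal.span_singleton_pow, Ideal.mem_span_singleton, map_mul] at h1
  exact hπ.pow_dvd_of_dvd_mul_left r (fun h => hs ((hQ s).2 h)) h1

theorem derivation_mem_pow {R A : Type*} [CommRing R] [CommRing A] [Algebra R A]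
    (D : Derivation R A A) (I : Ideal A) (n : ℕ) {g : A} (hg : g ∈ I ^ (n + 1)) :
    D g ∈ I ^ n := by
  induction n generalizing g with
  | zero => simp
  | succ n ih =>
    rw [pow_succ] at hg
    induction hg using Submodule.mul_induction_on' with
    | mem_mul_mem a ha b hb =>
      rw [D.leibniz, smul_eq_mul, smul_eq_mul]
      refine add_mem (Ideal.mul_mem_right _ _ ha) ?_
      rw [pow_succ']
      exact Ideal.mul_mem_mul hb (ih ha)
    | add a _ b _ ha hb => rw [map_add]; exact add_mem ha hb

/-- A derivation lowers symbolic powers by at most one. -/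
theorem derivation_mem_symbPow {R A : Type*} [CommRing R] [CommRing A] [Algebra R A]
    (D : Derivation R A A) (Q : Ideal A) [Q.IsPrime] {n : ℕ} {g : A}
    (hg : g ∈ symbPow Q (n + 1)) : D g ∈ symbPow Q n := by
  rw [mem_symbPow_iff] at *
  obtain ⟨s, hs, hsg⟩ := hg
  refine ⟨s * s, fun h => hs (or_self_iff.1 (‹Q.IsPrime›.mem_or_mem h)), ?_⟩
  have h1 := derivation_mem_pow D Q n hsg
  rw [D.leibniz, smul_eq_mul, smul_eq_mul] at h1
  have h2 : s * s * D g = s * (s * D g + g * D s) - (s * g) * D s := by ring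
  rw [h2]
  exact sub_mem (Ideal.mul_mem_left _ _ h1)
    (Ideal.mul_mem_right _ _ (Ideal.pow_le_pow_right (Nat.le_succ n) hsg))

theorem coeff_mem_symbPow_of_mem_symbolicRees {A : Type*} [CommRing A] (Q : Ideal A) [Q.IsPrime]
    {P : Polynomial A} (hP : P ∈ symbolicRees Q) (n : ℕ) : P.coeff n ∈ symbPow Q n := by
  induction hP using Algebra.adjoin_induction generalizing n with
  | mem P hP =>
    obtain ⟨m, p, hp, rfl⟩ := Set.mem_iUnion.1 hP
    simp only [Polynomial.coeff_C_mul, Polynomial.coeff_X_pow]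
    split_ifs with h
    · subst h; simpa using hp
    · simp
  | algebraMap a =>
    simp only [Polynomial.algebraMap_apply, Algebra.algebraMap_self, RingHom.id_apply,
      Polynomial.coeff_C]
    split_ifs with h
    · subst h; exact mem_symbPow_zero Q a
    · simp
  | add P R _ _ hP hR => rw [Polynomial.coeff_add]; exact add_mem (hP n) (hR n)
  | mul P R _ _ hP hR =>
    rw [Polynomial.coeff_mul]
    refine sum_mem fun x hx => ?_
    rw [← Finset.HasAntidiagonal.mem_antidiagonal.1 hx]
    exact mul_mem_symbPow (hP _) (hR _)

theorem monomial_mem_symbolicRees {A : Type*} [CommRing A] (Q : Ideal A) [Q.IsPrime] {n : ℕ}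
    {p : A} (hp : p ∈ symbPow Q n) :
    Polynomial.C p * Polynomial.X ^ n ∈ symbolicRees Q :=
  Algebra.subset_adjoin (Set.mem_iUnion.2 ⟨n, p, hp, rfl⟩)

/-- If the symbolic Rees algebra is Noetherian, then its ideal of elements of positive degree is
generated by finitely many homogeneous elements. -/
theorem exists_finset_generators {A : Type*} [CommRing A] (Q : Ideal A) [Q.IsPrime]
    (hN : IsNoetherianRing (symbolicRees Q)) :
    ∃ G : Finset (ℕ × A), (∀ p ∈ G, 1 ≤ p.1 ∧ p.2 ∈ symbPow Q p.1) ∧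
      ∀ r, 1 ≤ r → ∀ h ∈ symbPow Q r, ∃ a : ℕ × A → A,
        (∀ p ∈ G, p.1 ≤ r → a p ∈ symbPow Q (r - p.1)) ∧
        h = ∑ p ∈ G with p.1 ≤ r, a p * p.2 := by
  classical
  let ι : ℕ × A → Polynomial A := fun p => Polynomial.C p.2 * Polynomial.X ^ p.1
  let T : Set (ℕ × A) := {p | 1 ≤ p.1 ∧ p.2 ∈ symbPow Q p.1}
  let S : Set (symbolicRees Q) := {P | ∃ p ∈ T, (P : Polynomial A) = ι p}
  obtain ⟨S', hS', hspan⟩ := (Submodule.fg_span_iff_fg_span_finset_subset S).1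
    (hN.noetherian (Submodule.span _ S))
  choose! φ hφT hφ using fun P (hP : P ∈ S) => hP
  refine ⟨S'.image φ, ?_, ?_⟩
  · intro p hp
    obtain ⟨P, hP, rfl⟩ := Finset.mem_image.1 hp
    exact hφT P (hS' hP)
  · intro r hr h hh
    have hinj : Set.InjOn φ S' := fun P hP R hR hPR => by
      apply Subtype.ext
      rw [hφ P (hS' hP), hφ R (hS' hR), hPR]
    have hmem : (⟨ι (r, h), monomial_mem_symbolicRees Q hh⟩ : symbolicRees Q) ∈
        Submodule.span (symbolicRees Q) (S' : Set (symbolicRees Q)) := by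
      rw [← hspan]
      exact Submodule.subset_span ⟨(r, h), ⟨hr, hh⟩, rfl⟩
    obtain ⟨c, hc⟩ := Submodule.mem_span_finset.1 hmem
    have hc2 := congrArg (fun P : symbolicRees Q => (P : Polynomial A).coeff r) hc.2
    simp only [ι, Polynomial.coeff_C_mul, Polynomial.coeff_X_pow, if_true, mul_one,
      smul_eq_mul, AddSubmonoidClass.coe_finsetSum, Polynomial.finsetSum_coeff,
      MulMemClass.coe_mul] at hc2
    let ψ : ℕ × A → symbolicRees Q := Function.invFunOn φ S'
    have hψ : ∀ P ∈ S', ψ (φ P) = P := fun P hP => hinj.leftInvOn_invFunOn hP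
    refine ⟨fun p => (c (ψ p) : Polynomial A).coeff (r - p.1), ?_, ?_⟩
    · intro p _ _
      exact coeff_mem_symbPow_of_mem_symbolicRees Q (c (ψ p)).2 _
    · rw [← hc2, Finset.sum_filter, Finset.sum_image hinj]
      refine Finset.sum_congr rfl fun P hP => ?_
      simp only [hψ P hP]
      rw [hφ P (hS' hP), ← mul_assoc, Polynomial.coeff_mul_X_pow',
        Polynomial.coeff_mul_C]

noncomputable section

namespace SpaceMonomial

/-! ### A one-parameter family of curves through the singular locus -/

section Family

variable (K : Type*) [Field K]

/-- The quadratic factor of the image of `y`. -/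
def quad : Polynomial K := 1 + 3 * .X + .X ^ 2

/-- The quartic factor of the image of `z`. -/
def quart : Polynomial K := -(1 + 5 * .X + 7 * .X ^ 2 + 3 * .X ^ 3 + .X ^ 4)

/-- The polynomial whose roots are the parameters at which the family meets the monomial curve. -/
def septic : Polynomial K :=
  1 + 9 * .X + 30 * .X ^ 2 + 46 * .X ^ 3 + 35 * .X ^ 4 + 16 * .X ^ 5 + 4 * .X ^ 6 + .X ^ 7

/-- The weighted degree of an exponent. -/
def wdeg (m : Fin 3 →₀ ℕ) : ℕ := 5 * m 0 + 103 * m 1 + 169 * m 2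

/-- The image of the monomial with exponent `m` under the parametrization, as a polynomial in the
parameter. -/
def term (m : Fin 3 →₀ ℕ) : Polynomial K :=
  .X ^ (2 * m 0 + 39 * m 1 + 64 * m 2) * quad K ^ m 1 * quart K ^ m 2

/-- The parametrization `K[x,y,z] → K[s][w]` of a surface-sweeping family of curves. -/
def family : MvPolynomial (Fin 3) K →ₐ[K] Polynomial (Polynomial K) :=
  aeval ![.C (.X ^ 2) * .X ^ 5, .C (.X ^ 39 * quad K) * .X ^ 103, .C (.X ^ 64 * quart K) * .X ^ 169]

variable {K}

theorem family_monomial (m : Fin 3 →₀ ℕ) (c : K) :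
    family K (monomial m c) = .C (.C c * term K m) * .X ^ wdeg m := by
  rw [family, aeval_monomial, Finsupp.prod_fintype _ _ (fun _ => pow_zero _), Fin.prod_univ_three]
  simp only [Matrix.cons_val_zero, Matrix.cons_val_one, Matrix.cons_val]
  rw [show (algebraMap K (Polynomial (Polynomial K))) c = .C (.C c) from rfl]
  simp only [term, wdeg, map_mul, map_pow, mul_pow, pow_add, pow_mul]
  ring

/-- The coefficient of `w ^ d` in the image of a polynomial under the parametrization. -/
def cf (d : ℕ) : MvPolynomial (Fin 3) K →ₗ[K] Polynomial K :=
  ((Polynomial.lcoeff (Polynomial K) d).restrictScalars K) ∘ₗ (family K).toLinearMap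

theorem cf_apply (d : ℕ) (g : MvPolynomial (Fin 3) K) : cf d g = (family K g).coeff d := rfl

theorem cf_monomial (d : ℕ) (m : Fin 3 →₀ ℕ) (c : K) :
    cf d (monomial m c) = if wdeg m = d then .C c * term K m else 0 := by
  rw [cf_apply, family_monomial, Polynomial.coeff_C_mul, Polynomial.coeff_X_pow]
  simp [eq_comm]

theorem cf_eq_sum (d : ℕ) (g : MvPolynomial (Fin 3) K) :
    cf d g = ∑ m ∈ g.support with wdeg m = d, .C (coeff m g) * term K m := by
  conv_lhs => rw [g.as_sum, map_sum]
  simp only [cf_monomial, Finset.sum_filter]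

theorem septic_natDegree : (septic K).natDegree = 7 := by
  unfold septic; compute_degree!

theorem septic_monic : (septic K).Monic := by
  unfold septic; monicity!

theorem septic_derivative : (septic K).derivative =
    9 + 60 * .X + 138 * .X ^ 2 + 140 * .X ^ 3 + 80 * .X ^ 4 + 24 * .X ^ 5 + 7 * .X ^ 6 := by
  unfold septic
  simp only [Polynomial.derivative_add, Polynomial.derivative_mul, Polynomial.derivative_X_pow,
    Polynomial.derivative_X, Polynomial.derivative_ofNat, Polynomial.derivative_one]
  simp only [Nat.cast_ofNat, map_ofNat]
  ring

theorem septic_separable [CharZero K] : (septic K).Separable := by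
  have h : (353308 : Polynomial K) * .C (353308⁻¹) = 1 := by
    rw [← map_ofNat Polynomial.C, ← map_mul, mul_inv_cancel₀ (by norm_num), map_one]
  rw [Polynomial.separable_def, septic_derivative]
  refine ⟨.C (353308⁻¹) * (4134112681 + 15221828259 * .X + 17699603661 * .X ^ 2 +
    11111753159 * .X ^ 3 + 3309687299 * .X ^ 4 + 1067400537 * .X ^ 5),
    .C (353308⁻¹) * (-459306597 - 2763382952 * .X - 5503572324 * .X ^ 2
    - 4596456312 * .X ^ 3 - 2255902093 * .X ^ 4 - 559947209 * .X ^ 5 - 152485791 * .X ^ 6), ?_⟩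
  unfold septic
  linear_combination h

theorem isCoprime_X_septic : IsCoprime (.X : Polynomial K) (septic K) :=
  ⟨-9 - 30 * .X - 46 * .X ^ 2 - 35 * .X ^ 3 - 16 * .X ^ 4 - 4 * .X ^ 5 - .X ^ 6, 1, by
    unfold septic; ring⟩

theorem isCoprime_quad_septic : IsCoprime (quad K) (septic K) :=
  ⟨-609 - 3896 * .X - 8100 * .X ^ 2 - 6854 * .X ^ 3 - 3406 * .X ^ 4 - 843 * .X ^ 5 - 233 * .X ^ 6,
    610 + 233 * .X, by unfold septic quad; ring⟩

theorem isCoprime_quart_septic : IsCoprime (quart K) (septic K) :=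
  ⟨4255 + 25969 * .X + 52411 * .X ^ 2 + 43952 * .X ^ 3 + 21661 * .X ^ 4 + 5371 * .X ^ 5 +
    1470 * .X ^ 6, 4256 + 8940 * .X + 3901 * .X ^ 2 + 1470 * .X ^ 3, by
    unfold septic quart; ring⟩

theorem exists_scale {e Y Z : K} (he0 : e ≠ 0) (hY5 : Y ^ 5 = e ^ 206) (hZY : Z * Y ^ 2 = e ^ 150) :
    Y ^ 2 / e ^ 82 ≠ 0 ∧ (Y ^ 2 / e ^ 82) ^ 5 = e ^ 2 ∧ (Y ^ 2 / e ^ 82) ^ 103 = Y ∧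
      (Y ^ 2 / e ^ 82) ^ 169 = Z := by
  have hY0 : Y ≠ 0 := by
    rintro rfl
    exact pow_ne_zero 206 he0 (by rw [← hY5, zero_pow (by norm_num)])
  refine ⟨div_ne_zero (pow_ne_zero _ hY0) (pow_ne_zero _ he0), ?_, ?_, ?_⟩ <;>
    rw [div_pow, div_eq_iff (pow_ne_zero _ (pow_ne_zero _ he0)), ← pow_mul, ← pow_mul]
  · rw [show 2 * 5 = 5 * 2 from rfl, pow_mul Y, hY5]; ring
  · rw [show 2 * 103 = 5 * 41 + 1 from rfl, pow_succ, pow_mul Y, hY5, ← pow_mul, mul_comm]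
  · refine mul_right_cancel₀ (pow_ne_zero 2 hY0) ?_
    rw [← pow_add, show 2 * 169 + 2 = 5 * 68 from rfl, pow_mul Y, hY5, mul_right_comm, hZY,
      ← pow_mul, ← pow_add]

/-- Over a root of `septic`, the parametrization is a rescaling of the monomial curve. -/
theorem mem_pIdeal_iff_dvd_family {e : K} (he : (septic K).eval e = 0)
    (q : MvPolynomial (Fin 3) K) :
    q ∈ pIdeal K 5 103 169 ↔ Polynomial.C (.X - .C e) ∣ family K q := by
  have hΨ : 1 + 9 * e + 30 * e ^ 2 + 46 * e ^ 3 + 35 * e ^ 4 + 16 * e ^ 5 + 4 * e ^ 6 + e ^ 7 = 0 := by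
    simpa [septic] using he
  have he0 : e ≠ 0 := by rintro rfl; norm_num at hΨ
  set Y := e ^ 39 * (1 + 3 * e + e ^ 2) with hY
  set Z := e ^ 64 * -(1 + 5 * e + 7 * e ^ 2 + 3 * e ^ 3 + e ^ 4) with hZ
  have hY5 : Y ^ 5 = e ^ 206 := by
    rw [hY]; linear_combination (e ^ 195 * (1 + 6 * e + 11 * e ^ 2 + 5 * e ^ 3 - e ^ 4)) * hΨ
  have hZY : Z * Y ^ 2 = e ^ 150 := by
    rw [hY, hZ]; linear_combination (e ^ 142 * (-1 - 2 * e)) * hΨ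
  obtain ⟨hc0, h5, h103, h169⟩ := exists_scale he0 hY5 hZY
  have hcomp : ((Polynomial.mapAlgHom (Polynomial.aeval e)).comp (family K)) =
      (Polynomial.aeval (.C (Y ^ 2 / e ^ 82) * .X)).comp (toPoly K 5 103 169) := by
    refine MvPolynomial.algHom_ext fun i => ?_
    have hC (k : ℕ) : (Polynomial.C (Y ^ 2 / e ^ 82) * .X : Polynomial K) ^ k =
        .C ((Y ^ 2 / e ^ 82) ^ k) * .X ^ k := by rw [mul_pow, map_pow]
    fin_cases i
    · simp [family, toPoly, hC, h5]
    · simp [family, toPoly, hC, h103, quad]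
      simp [hY]
    · simp [family, toPoly, hC, h169, hZ, quart]
  have hdvd : Polynomial.C (.X - .C e) ∣ family K q ↔
      Polynomial.mapAlgHom (Polynomial.aeval e) (family K q) = 0 := by
    rw [Polynomial.C_dvd_iff_dvd_coeff, Polynomial.ext_iff]
    refine forall_congr' fun n => ?_
    simp [Polynomial.dvd_iff_isRoot]
  have h1 : Polynomial.mapAlgHom (Polynomial.aeval e) (family K q) =
      (toPoly K 5 103 169 q).comp (.C (Y ^ 2 / e ^ 82) * .X) :=
    DFunLike.congr_fun hcomp q
  rw [hdvd, h1, Polynomial.comp_C_mul_X_eq_zero_iff (mem_nonZeroDivisors_of_ne_zero hc0)]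
  rfl

end Family

section Divisibility

variable {K : Type*} [Field K]

theorem septic_pow_dvd_cf [IsAlgClosed K] [CharZero K] {r : ℕ} {g : MvPolynomial (Fin 3) K}
    (hg : g ∈ symbPow (pIdeal K 5 103 169) r) (d : ℕ) : septic K ^ r ∣ cf d g := by
  classical
  have hne : septic K ≠ 0 := septic_monic.ne_zero
  have hprod : septic K = ∏ e ∈ (septic K).roots.toFinset, (.X - .C e) := by
    conv_lhs => rw [(IsAlgClosed.splits (septic K)).eq_prod_roots_of_monic septic_monic]
    rw [Finset.prod, Multiset.toFinset_val,
      Multiset.dedup_eq_self.2 (Polynomial.nodup_roots septic_separable)]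
  rw [hprod, ← Finset.prod_pow]
  refine Finset.prod_dvd_of_coprime (fun a _ b _ hab => ?_) fun e he => ?_
  · exact (Polynomial.isCoprime_X_sub_C_of_isUnit_sub (sub_ne_zero.2 hab).isUnit).pow
  · have he' : (septic K).eval e = 0 :=
      (Polynomial.mem_roots hne).1 (Multiset.mem_toFinset.1 he)
    have h1 := pow_dvd_of_mem_symbPow (pIdeal K 5 103 169) (family K).toRingHom
      (Polynomial.prime_C_iff.2 (Polynomial.prime_X_sub_C e)) (mem_pIdeal_iff_dvd_family he') hg
    rw [← map_pow, Polynomial.C_dvd_iff_dvd_coeff] at h1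
    exact h1 d

theorem natDegree_quad_le : (quad K).natDegree ≤ 2 := by unfold quad; compute_degree

theorem natDegree_quart_le : (quart K).natDegree ≤ 4 := by unfold quart; compute_degree

theorem quad_monic : (quad K).Monic := by unfold quad; monicity!

theorem neg_quart_monic : (-quart K).Monic := by unfold quart; rw [neg_neg]; monicity!

theorem quad_ne_zero : quad K ≠ 0 := quad_monic.ne_zero

theorem quart_ne_zero : quart K ≠ 0 := neg_ne_zero.1 neg_quart_monic.ne_zero

theorem natDegree_quad : (quad K).natDegree = 2 := by unfold quad; compute_degree!

theorem natDegree_quart : (quart K).natDegree = 4 := by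
  rw [← Polynomial.natDegree_neg]; unfold quart; rw [neg_neg]; compute_degree!

theorem natDegree_term_le (m : Fin 3 →₀ ℕ) :
    (term K m).natDegree ≤ 2 * m 0 + 41 * m 1 + 68 * m 2 := by
  refine Polynomial.natDegree_mul_le.trans ((Nat.add_le_add Polynomial.natDegree_mul_le
    (Polynomial.natDegree_pow_le_of_le _ natDegree_quart_le)).trans ?_)
  have h1 := Polynomial.natDegree_pow_le_of_le (m 1) (natDegree_quad_le (K := K))
  rw [Polynomial.natDegree_X_pow]
  omega

theorem X_pow_dvd_term {a : ℕ} {m : Fin 3 →₀ ℕ} (h : a ≤ 2 * m 0 + 39 * m 1 + 64 * m 2) :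
    .X ^ a ∣ term K m :=
  ((pow_dvd_pow _ h).mul_right _).mul_right _

theorem natDegree_cf_le (d : ℕ) (g : MvPolynomial (Fin 3) K) : 169 * (cf d g).natDegree ≤ 68 * d := by
  suffices h : (cf d g).natDegree ≤ 68 * d / 169 by omega
  rw [cf_eq_sum]
  refine Polynomial.natDegree_sum_le_of_forall_le _ _ fun m hm => ?_
  refine (Polynomial.natDegree_C_mul_le _ _).trans ((natDegree_term_le m).trans ?_)
  have h := (Finset.mem_filter.1 hm).2
  rw [wdeg] at h
  omega

theorem X_pow_dvd_cf {a d : ℕ} (h : 103 * a ≤ 39 * d + 102) (g : MvPolynomial (Fin 3) K) :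
    .X ^ a ∣ cf d g := by
  rw [cf_eq_sum]
  refine Finset.dvd_sum fun m hm => (X_pow_dvd_term ?_).mul_left _
  have h := (Finset.mem_filter.1 hm).2
  rw [wdeg] at h
  omega

/-- An element of the `r`-th symbolic power has, in degree `d`, image
`s ^ a * septic ^ r * q` with `q` of controlled degree. -/
theorem exists_cf_eq [IsAlgClosed K] [CharZero K] {r : ℕ} {g : MvPolynomial (Fin 3) K}
    (hg : g ∈ symbPow (pIdeal K 5 103 169) r) (d : ℕ) :
    ∃ q : Polynomial K, cf d g = .X ^ ((39 * d + 102) / 103) * septic K ^ r * q ∧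
      (cf d g ≠ 0 → 17407 * q.natDegree + 121849 * r ≤ 413 * d) := by
  obtain ⟨q, hq⟩ := (isCoprime_X_septic.pow : IsCoprime (.X ^ ((39 * d + 102) / 103)) (septic K ^ r)
    ).mul_dvd (X_pow_dvd_cf (by omega) g) (septic_pow_dvd_cf hg d)
  refine ⟨q, hq, fun h0 => ?_⟩
  have hq0 : q ≠ 0 := by rintro rfl; exact h0 (by rw [hq, mul_zero])
  have h1 := natDegree_cf_le d g
  rw [hq, Polynomial.Monic.natDegree_mul' ((Polynomial.monic_X_pow _).mul (septic_monic.pow _)) hq0,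
    (Polynomial.monic_X_pow _).natDegree_mul (septic_monic.pow _), Polynomial.natDegree_X_pow,
    septic_monic.natDegree_pow, septic_natDegree] at h1
  omega

theorem le_of_cf_ne_zero [IsAlgClosed K] [CharZero K] {r d : ℕ} {g : MvPolynomial (Fin 3) K}
    (hg : g ∈ symbPow (pIdeal K 5 103 169) r) (h : cf d g ≠ 0) : 121849 * r ≤ 413 * d := by
  obtain ⟨q, -, hq⟩ := exists_cf_eq hg d
  have := hq h
  omega

end Divisibility

section Euler

variable {K : Type*} [Field K]

/-- The image under the parametrization of the partial Euler operator `xᵢ ∂ᵢ`. -/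
def eulerCf (d : ℕ) (i : Fin 3) (g : MvPolynomial (Fin 3) K) : Polynomial K :=
  cf d (X i * pderiv i g)

theorem eulerCf_eq_sum (d : ℕ) (i : Fin 3) (g : MvPolynomial (Fin 3) K) :
    eulerCf d i g = ∑ m ∈ g.support with wdeg m = d, m i • (.C (coeff m g) * term K m) := by
  conv_lhs => rw [g.as_sum, eulerCf]
  simp only [map_sum, Finset.mul_sum, X_mul_pderiv_monomial, map_nsmul, cf_monomial,
    Finset.sum_filter, smul_ite, smul_zero]

theorem dvd_eulerCf {P : Polynomial K} {d : ℕ} {i : Fin 3} (g : MvPolynomial (Fin 3) K)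
    (h : ∀ m : Fin 3 →₀ ℕ, wdeg m = d → m i ≠ 0 → P ∣ term K m) : P ∣ eulerCf d i g := by
  rw [eulerCf_eq_sum]
  refine Finset.dvd_sum fun m hm => ?_
  rcases eq_or_ne (m i) 0 with h0 | h0
  · simp [h0]
  · rw [nsmul_eq_mul]
    exact ((h m (Finset.mem_filter.1 hm).2 h0).mul_left _).mul_left _

theorem septic_pow_dvd_eulerCf [IsAlgClosed K] [CharZero K] {r : ℕ} {g : MvPolynomial (Fin 3) K}
    (hg : g ∈ symbPow (pIdeal K 5 103 169) (r + 1)) (d : ℕ) (i : Fin 3) :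
    septic K ^ r ∣ eulerCf d i g :=
  septic_pow_dvd_cf (Ideal.mul_mem_left _ _ (derivation_mem_symbPow (pderiv i) _ hg)) d

theorem natDegree_eulerCf_le {d k : ℕ} {i : Fin 3} (g : MvPolynomial (Fin 3) K)
    (h : ∀ m : Fin 3 →₀ ℕ, wdeg m = d → m i ≠ 0 → 2 * m 0 + 41 * m 1 + 68 * m 2 ≤ k) :
    (eulerCf d i g).natDegree ≤ k := by
  rw [eulerCf_eq_sum]
  refine Polynomial.natDegree_sum_le_of_forall_le _ _ fun m hm => ?_
  rcases eq_or_ne (m i) 0 with h0 | h0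
  · simp [h0]
  · exact (Polynomial.natDegree_smul_le _ _).trans ((Polynomial.natDegree_C_mul_le _ _).trans
      ((natDegree_term_le m).trans (h m (Finset.mem_filter.1 hm).2 h0)))

theorem sum_eulerCf (d : ℕ) (g : MvPolynomial (Fin 3) K) :
    5 * eulerCf d 0 g + 103 * eulerCf d 1 g + 169 * eulerCf d 2 g = d * cf d g := by
  simp only [eulerCf_eq_sum, cf_eq_sum, Finset.mul_sum, ← Finset.sum_add_distrib]
  refine Finset.sum_congr rfl fun m hm => ?_
  rw [← (Finset.mem_filter.1 hm).2, wdeg]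
  simp only [nsmul_eq_mul]
  push_cast
  ring

theorem mul_derivative_pow (P : Polynomial K) (n : ℕ) :
    P * (P ^ n).derivative = n * P.derivative * P ^ n := by
  rw [Polynomial.derivative_pow, ← Polynomial.C_eq_natCast]
  rcases n with _ | n
  · simp
  · rw [Nat.add_sub_cancel]; ring

theorem derivative_term (m : Fin 3 →₀ ℕ) :
    .X * quad K * quart K * (term K m).derivative =
      ((2 * m 0 + 39 * m 1 + 64 * m 2 : ℕ) * (quad K * quart K) +
        m 1 * (.X * (quad K).derivative * quart K) +
        m 2 * (.X * (quart K).derivative * quad K)) * term K m := by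
  have h1 := mul_derivative_pow (K := K) .X (2 * m 0 + 39 * m 1 + 64 * m 2)
  have h2 := mul_derivative_pow (quad K) (m 1)
  have h3 := mul_derivative_pow (quart K) (m 2)
  rw [Polynomial.derivative_X] at h1
  rw [term, Polynomial.derivative_mul, Polynomial.derivative_mul]
  generalize (Polynomial.X : Polynomial K) ^ (2 * m 0 + 39 * m 1 + 64 * m 2) = U at *
  generalize quad K ^ m 1 = V at *
  generalize quart K ^ m 2 = W at *
  linear_combination quad K * quart K * V * W * h1 + .X * quart K * U * W * h2 +
    .X * quad K * U * V * h3

theorem derivative_cf (d : ℕ) (g : MvPolynomial (Fin 3) K) :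
    .X * quad K * quart K * (cf d g).derivative =
      quad K * quart K * (2 * eulerCf d 0 g + 39 * eulerCf d 1 g + 64 * eulerCf d 2 g) +
      .X * (quad K).derivative * quart K * eulerCf d 1 g +
      .X * (quart K).derivative * quad K * eulerCf d 2 g := by
  simp only [eulerCf_eq_sum, cf_eq_sum, Finset.mul_sum, ← Finset.sum_add_distrib,
    Polynomial.derivative_sum, Polynomial.derivative_C_mul]
  refine Finset.sum_congr rfl fun m hm => ?_
  rw [mul_left_comm, derivative_term]
  simp only [nsmul_eq_mul]
  push_cast
  ring

end Euler

section Extremal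

variable {K : Type*} [Field K]

theorem natDegree_le_of_mul_monic {M q : Polynomial K} (hM : M.Monic) {a k : ℕ}
    (hMa : M.natDegree = a) (h : (M * q).natDegree ≤ a + k) : q.natDegree ≤ k := by
  rcases eq_or_ne q 0 with rfl | hq
  · simp
  · rw [hM.natDegree_mul' hq] at h
    omega

/-- The linear algebra excluding extremal degrees. -/
theorem eq_zero_of_extremal_equations [CharZero K] {A B C : Polynomial K} {t : K}
    (hA : A.natDegree ≤ 5) (hB : B.natDegree ≤ 4) (hC : C.natDegree ≤ 2)
    (h1 : 5 * (.X * A) + 103 * (quad K * B) + 169 * (.X * quart K * C) =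
      .C (17407 * t) * septic K)
    (h2 : 2 * (.X * A) + (39 * quad K + .X * (quad K).derivative) * B +
      (64 * quart K + .X * (quart K).derivative) * (.X * C) =
      .C (6591 * t) * septic K + .C (59 * t) * .X * (septic K).derivative)
    (h3 : A.coeff 5 = 47 * B.coeff 4) : t = 0 := by
  have dq : (quad K).derivative = 3 + 2 * .X := by
    unfold quad
    simp only [Polynomial.derivative_add, Polynomial.derivative_mul, Polynomial.derivative_X_pow,
      Polynomial.derivative_X, Polynomial.derivative_ofNat, Polynomial.derivative_one,
      Nat.cast_ofNat, map_ofNat]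
    ring
  have dr : (quart K).derivative = -(5 + 14 * .X + 9 * .X ^ 2 + 4 * .X ^ 3) := by
    unfold quart
    simp only [Polynomial.derivative_add, Polynomial.derivative_mul, Polynomial.derivative_X_pow,
      Polynomial.derivative_X, Polynomial.derivative_ofNat, Polynomial.derivative_one,
      Polynomial.derivative_neg, Nat.cast_ofNat, map_ofNat]
    ring
  rw [dq, dr, septic_derivative] at h2
  unfold quad quart septic at *
  have e1 (x : K) := congrArg (Polynomial.eval x) h1
  have e2 (x : K) := congrArg (Polynomial.eval x) h2
  simp only [Polynomial.eval_add, Polynomial.eval_mul, Polynomial.eval_pow, Polynomial.eval_neg,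
    Polynomial.eval_X, Polynomial.eval_C, Polynomial.eval_ofNat, Polynomial.eval_one,
    Polynomial.eval_eq_sum_range' (Nat.lt_succ_of_le hA),
    Polynomial.eval_eq_sum_range' (Nat.lt_succ_of_le hB),
    Polynomial.eval_eq_sum_range' (Nat.lt_succ_of_le hC),
    Nat.succ_eq_add_one, Nat.reduceAdd, Finset.sum_range_succ, Finset.sum_range_zero] at e1 e2
  linear_combination (121824823/664203494448 : K) * e1 0 + (-1524221/1612144404 : K) * e1 1 +
    (22519/9539316 : K) * e2 1 + (10738421/2686907340 : K) * e1 (-1) +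
    (-381419/38157264 : K) * e2 (-1) + (233807/1194181040 : K) * e1 2 +
    (-46651/95393160 : K) * e2 2 + (-9964381/32242888080 : K) * e1 (-2) +
    (73889/95393160 : K) * e2 (-2) + (-128621/8060722020 : K) * e1 3 +
    (23011/572358960 : K) * e2 3 + (75349/8060722020 : K) * e1 (-3) +
    (-6787/286179480 : K) * e2 (-3) + (-109/2480222160 : K) * e1 4 + (1/1521 : K) * h3

theorem coeff_eulerCf_zero (n : ℕ) (g : MvPolynomial (Fin 3) K) :
    (eulerCf (17407 * n) 0 g).coeff (7004 * n - 1) =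
      47 * (eulerCf (17407 * n) 1 g).coeff (7004 * n - 1) := by
  simp only [eulerCf_eq_sum, Polynomial.finsetSum_coeff, Finset.mul_sum]
  refine Finset.sum_congr rfl fun m hm => ?_
  have hd := (Finset.mem_filter.1 hm).2
  rw [wdeg] at hd
  have hdeg := natDegree_term_le (K := K) m
  simp only [Polynomial.coeff_smul, Polynomial.coeff_C_mul]
  simp only [nsmul_eq_mul]
  rcases eq_or_ne (m 0) (47 * m 1) with h | h
  · rw [h]; push_cast; ring
  · have hD : 169 * (2 * m 0 + 41 * m 1 + 68 * m 2) + (2 * m 0 + 75 * m 1) = 169 * (7004 * n) := by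
      omega
    generalize 2 * m 0 + 41 * m 1 + 68 * m 2 = D at hdeg hD
    clear hd
    rcases eq_or_ne (m 0) 0 with h0 | h0
    · rcases eq_or_ne (m 1) 0 with h1 | h1
      · simp [h0, h1]
      · rw [Polynomial.coeff_eq_zero_of_natDegree_lt (by omega)]
        simp
    · rw [Polynomial.coeff_eq_zero_of_natDegree_lt (by omega)]
      simp

/-- No element of the `59n`-th symbolic power has nonzero image in the extremal degree. -/
theorem cf_eq_zero_of_extremal [IsAlgClosed K] [CharZero K] {n : ℕ} (hn : n ≠ 0)
    {g : MvPolynomial (Fin 3) K} (hg : g ∈ symbPow (pIdeal K 5 103 169) (59 * n)) :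
    cf (17407 * n) g = 0 := by
  obtain ⟨N, hN⟩ : ∃ N, 59 * n = N + 1 := ⟨59 * n - 1, by omega⟩
  set d := 17407 * n with hd
  set a := 6591 * n with ha
  by_contra hg0
  obtain ⟨q, hq, hqdeg⟩ := exists_cf_eq hg d
  have hq0 : q.natDegree = 0 := by have := hqdeg hg0; omega
  obtain ⟨c, rfl⟩ := Polynomial.natDegree_eq_zero.1 hq0
  rw [show (39 * d + 102) / 103 = a by omega, hN] at hq
  rw [hN] at hg
  set M : Polynomial K := .X ^ a * septic K ^ N with hM
  have hMmonic : M.Monic := (Polynomial.monic_X_pow _).mul (septic_monic.pow _)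
  have hMdeg : M.natDegree = a + 7 * N := by
    rw [hM, (Polynomial.monic_X_pow _).natDegree_mul (septic_monic.pow _),
      Polynomial.natDegree_X_pow, septic_monic.natDegree_pow, septic_natDegree, mul_comm]
  have hP : cf d g = M * (septic K * .C c) := by rw [hq, hM, pow_succ]; ring
  have hXA : ∃ A, eulerCf d 0 g = M * (.X * A) := by
    obtain ⟨A, hA⟩ := (isCoprime_X_septic.pow : IsCoprime (.X ^ (a + 1)) (septic K ^ N)).mul_dvd
      (dvd_eulerCf g fun m hm h0 => X_pow_dvd_term (by rw [wdeg] at hm; omega))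
      (septic_pow_dvd_eulerCf hg d 0)
    exact ⟨A, by rw [hA, hM]; ring⟩
  have hXB : ∃ B, eulerCf d 1 g = M * (quad K * B) := by
    obtain ⟨B, hB⟩ := ((isCoprime_X_septic.pow : IsCoprime (.X ^ a) (septic K ^ N)).mul_left
      (isCoprime_quad_septic.pow_right)).mul_dvd
      (dvd_eulerCf (i := 1) g fun m hm h0 => ((mul_dvd_mul
        (pow_dvd_pow _ (by rw [wdeg] at hm; omega)) (dvd_pow_self _ h0)).mul_right _))
      (septic_pow_dvd_eulerCf hg d 1)
    exact ⟨B, by rw [hB, hM]; ring⟩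
  have hXC : ∃ C, eulerCf d 2 g = M * (.X * quart K * C) := by
    obtain ⟨C, hC⟩ := ((isCoprime_X_septic.pow : IsCoprime (.X ^ (a + 1)) (septic K ^ N)).mul_left
      (isCoprime_quart_septic.pow_right)).mul_dvd
      (dvd_eulerCf (i := 2) g fun m hm h0 => (mul_dvd_mul
        ((pow_dvd_pow _ (by rw [wdeg] at hm; omega)).mul_right _) (dvd_pow_self _ h0)))
      (septic_pow_dvd_eulerCf hg d 2)
    exact ⟨C, by rw [hC, hM]; ring⟩
  obtain ⟨A, hA⟩ := hXA
  obtain ⟨B, hB⟩ := hXB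
  obtain ⟨C, hC⟩ := hXC
  have hAdeg : A.natDegree ≤ 5 := by
    have h := natDegree_eulerCf_le (k := 7004 * n - 1) (i := 0) (d := d) g fun m hm h0 => by
      rw [wdeg] at hm; omega
    rw [hA, ← mul_assoc] at h
    exact natDegree_le_of_mul_monic (hMmonic.mul Polynomial.monic_X) rfl (h.trans (by
      rw [hMmonic.natDegree_mul Polynomial.monic_X, hMdeg, Polynomial.natDegree_X]; omega))
  have hBdeg : B.natDegree ≤ 4 := by
    have h := natDegree_eulerCf_le (k := 7004 * n - 1) (i := 1) (d := d) g fun m hm h0 => by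
      rw [wdeg] at hm; omega
    rw [hB, ← mul_assoc] at h
    exact natDegree_le_of_mul_monic (hMmonic.mul quad_monic) rfl (h.trans (by
      rw [hMmonic.natDegree_mul quad_monic, hMdeg, natDegree_quad]; omega))
  have hCdeg : C.natDegree ≤ 2 := by
    have h := natDegree_eulerCf_le (k := 7004 * n) (i := 2) (d := d) g fun m hm h0 => by
      rw [wdeg] at hm; omega
    rw [hC, show M * (.X * quart K * C) = M * .X * -quart K * -C by ring] at h
    have hm := (hMmonic.mul Polynomial.monic_X).mul neg_quart_monic
    rw [← Polynomial.natDegree_neg]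
    refine natDegree_le_of_mul_monic hm rfl (h.trans ?_)
    rw [(hMmonic.mul Polynomial.monic_X).natDegree_mul neg_quart_monic,
      hMmonic.natDegree_mul Polynomial.monic_X, hMdeg, Polynomial.natDegree_neg,
      natDegree_quart, Polynomial.natDegree_X]
    omega
  have h1 := sum_eulerCf d g
  have h2 := derivative_cf d g
  have h3 := coeff_eulerCf_zero n g
  rw [hA, hB, hC] at h1 h2
  rw [← hd, hA, hB, show 7004 * n - 1 = (a + 7 * N) + (1 + 5) by omega,
    Polynomial.coeff_mul_add_eq_of_natDegree_le hMdeg.le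
      (Polynomial.natDegree_mul_le_of_le Polynomial.natDegree_X_le hAdeg),
    show 1 + 5 = 2 + 4 by norm_num,
    Polynomial.coeff_mul_add_eq_of_natDegree_le hMdeg.le
      (Polynomial.natDegree_mul_le_of_le natDegree_quad.le hBdeg),
    Polynomial.coeff_mul_add_eq_of_natDegree_le natDegree_quad.le hBdeg, ← hMdeg,
    hMmonic.coeff_natDegree, ← natDegree_quad (K := K), quad_monic.coeff_natDegree, natDegree_quad,
    Polynomial.coeff_X_mul, one_mul, one_mul, one_mul] at h3
  have hnc : (n : K) * c = 0 := by
    refine eq_zero_of_extremal_equations hAdeg hBdeg hCdeg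
      (mul_left_cancel₀ hMmonic.ne_zero ?_) (mul_left_cancel₀ (mul_ne_zero (mul_ne_zero
      (mul_ne_zero hMmonic.ne_zero septic_monic.ne_zero) quad_ne_zero) quart_ne_zero) ?_) h3
    · rw [hP, hd] at h1
      simp only [map_mul, map_ofNat, map_natCast]
      push_cast at h1
      linear_combination h1
    · have hU := mul_derivative_pow (K := K) .X a
      have hV := mul_derivative_pow (septic K) (N + 1)
      rw [hq, Polynomial.derivative_mul, Polynomial.derivative_C, Polynomial.derivative_mul] at h2
      rw [Polynomial.derivative_X] at hU
      rw [← hN] at hV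
      simp only [map_mul, map_ofNat, map_natCast]
      rw [hM]
      have hpow : septic K ^ (59 * n) = septic K ^ N * septic K := by rw [hN, pow_succ]
      rw [← hN, hpow] at h2
      rw [hpow] at hV
      rw [hM] at h2
      generalize (Polynomial.derivative (septic K ^ N * septic K)) = V' at *
      generalize (Polynomial.derivative ((Polynomial.X : Polynomial K) ^ a)) = U' at *
      have ha' : (a : Polynomial K) = 6591 * n := by rw [ha]; push_cast; ring
      rw [ha'] at hU
      push_cast at hV
      linear_combination -septic K * h2 +
        septic K * quad K * quart K * septic K ^ N * septic K * .C c * hU +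
        .X * quad K * quart K * .X ^ a * .C c * hV
  rcases mul_eq_zero.1 hnc with h | h
  · exact hn (by exact_mod_cast h)
  · exact hg0 (by rw [hq, h, map_zero, mul_zero])

end Extremal

/-! ### Symbolic powers of the monomial curve via Taylor expansion -/

section Taylor

variable {K : Type*} [Field K]

/-- The Taylor expansion transverse to the monomial curve: `w` parametrizes the curve and the two
variables are transverse coordinates. -/
def taylor : MvPolynomial (Fin 3) K →ₐ[K] MvPolynomial (Fin 2) (Polynomial K) :=
  aeval ![C (.X ^ 5) * (1 + X 0) ^ 2 * (1 + X 1), C (.X ^ 103) * (1 + X 0) ^ 39,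
    C (.X ^ 169) * (1 + X 0) ^ 64]

/-- The order of vanishing along the monomial curve. -/
def ord (g : MvPolynomial (Fin 3) K) : ℕ∞ :=
  (taylor g : MvPowerSeries (Fin 2) (Polynomial K)).order

theorem ord_mul (g h : MvPolynomial (Fin 3) K) : ord (g * h) = ord g + ord h := by
  rw [ord, map_mul, MvPolynomial.coe_mul, MvPowerSeries.order_mul, ord, ord]

theorem le_ord_iff (r : ℕ) (g : MvPolynomial (Fin 3) K) :
    (r : ℕ∞) ≤ ord g ↔ ∀ m : Fin 2 →₀ ℕ, m.degree < r → coeff m (taylor g) = 0 := by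
  constructor
  · intro h m hm
    rw [← MvPolynomial.coeff_coe]
    exact MvPowerSeries.coeff_of_lt_order (lt_of_lt_of_le (by exact_mod_cast hm) h)
  · intro h
    exact MvPowerSeries.nat_le_order fun m hm => by rw [MvPolynomial.coeff_coe]; exact h m hm

theorem constantCoeff_taylor (g : MvPolynomial (Fin 3) K) :
    constantCoeff (taylor g) = toPoly K 5 103 169 g := by
  have h : (constantCoeff.comp (taylor (K := K)).toRingHom) =
      (toPoly K 5 103 169).toRingHom := by
    refine MvPolynomial.ringHom_ext (fun c => ?_) fun i => ?_
    · simp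
    · fin_cases i <;> simp [taylor, toPoly]
  exact DFunLike.congr_fun h g

theorem mem_pIdeal_iff_ord (g : MvPolynomial (Fin 3) K) :
    g ∈ pIdeal K 5 103 169 ↔ ((1 : ℕ) : ℕ∞) ≤ ord g := by
  rw [le_ord_iff, pIdeal, RingHom.mem_ker]
  change toPoly K 5 103 169 g = 0 ↔ _
  rw [← constantCoeff_taylor, constantCoeff_eq]
  constructor
  · intro h m hm
    rw [(Finsupp.degree_eq_zero_iff m).1 (by omega)]
    exact h
  · intro h
    exact h 0 (by simp)

theorem le_ord_add {r : ℕ} {g h : MvPolynomial (Fin 3) K} (hg : (r : ℕ∞) ≤ ord g)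
    (hh : (r : ℕ∞) ≤ ord h) : (r : ℕ∞) ≤ ord (g + h) := by
  rw [le_ord_iff] at *
  intro m hm
  rw [map_add, coeff_add, hg m hm, hh m hm, add_zero]

theorem le_ord_of_mem_pow {r : ℕ} {g : MvPolynomial (Fin 3) K} (hg : g ∈ pIdeal K 5 103 169 ^ r) :
    (r : ℕ∞) ≤ ord g := by
  induction r generalizing g with
  | zero => simp
  | succ r ih =>
    rw [pow_succ] at hg
    refine Submodule.mul_induction_on hg (fun a ha b hb => ?_) fun a b => le_ord_add
    rw [ord_mul]
    push_cast
    exact add_le_add (ih ha) (by simpa using (mem_pIdeal_iff_ord b).1 hb)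

theorem mem_symbPow_of_le_ord {r : ℕ} {g : MvPolynomial (Fin 3) K} (hg : (r : ℕ∞) ≤ ord g) :
    g ∈ symbPow (pIdeal K 5 103 169) r := by
  set p := pIdeal K 5 103 169 with hp
  let ι := algebraMap (MvPolynomial (Fin 3) K) (Localization.AtPrime p)
  have hmem (q : MvPolynomial (Fin 3) K) : q ∈ p ↔ toPoly K 5 103 169 q = 0 := Iff.rfl
  have hunit (i : Fin 3) (hi : toPoly K 5 103 169 (X i) ≠ 0) : ∃ u, ι (X i) * u = 1 :=
    (IsLocalization.map_units (Localization.AtPrime p)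
      (⟨X i, fun h => hi ((hmem _).1 h)⟩ : p.primeCompl)).exists_right_inv
  obtain ⟨y', hy⟩ := hunit 1 (by simp [toPoly])
  obtain ⟨z', hz⟩ := hunit 2 (by simp [toPoly])
  set x := ι (X 0) with hx
  set y := ι (X 1) with hy'
  set z := ι (X 2) with hz'
  let U := z ^ 103 * y' ^ 169
  let V := x * y ^ 18 * z' ^ 11
  let ev : MvPolynomial (Fin 2) (Polynomial K) →+* Localization.AtPrime p :=
    eval₂Hom (Polynomial.eval₂RingHom (ι.comp C) (y ^ 64 * z' ^ 39)) ![U - 1, V - 1]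
  have hev : ev.comp (taylor (K := K)).toRingHom = ι := by
    refine MvPolynomial.ringHom_ext (fun c => ?_) fun i => ?_
    · simp [ev, taylor, MvPolynomial.algebraMap_apply]
    · fin_cases i
      · suffices (y ^ 64 * z' ^ 39) ^ 5 * U ^ 2 * V = x by simpa [taylor, ev]
        calc _ = x * (y * y') ^ 338 * (z * z') ^ 206 := by simp only [U, V]; ring
          _ = x := by rw [hy, hz, one_pow, one_pow, mul_one, mul_one]
      · suffices (y ^ 64 * z' ^ 39) ^ 103 * U ^ 39 = y by simpa [taylor, ev]
        calc _ = y * (y * y') ^ 6591 * (z * z') ^ 4017 := by simp only [U]; ring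
          _ = y := by rw [hy, hz, one_pow, one_pow, mul_one, mul_one]
      · suffices (y ^ 64 * z' ^ 39) ^ 169 * U ^ 64 = z by simpa [taylor, ev]
        calc _ = z * (y * y') ^ 10816 * (z * z') ^ 6591 := by simp only [U]; ring
          _ = z := by rw [hy, hz, one_pow, one_pow, mul_one, mul_one]
  have hU : U - 1 ∈ p.map ι := by
    have h : X 2 ^ 103 - X 1 ^ 169 ∈ p := by
      rw [hmem]; simp [toPoly, ← pow_mul]
    have h2 : U - 1 = ι (X 2 ^ 103 - X 1 ^ 169) * y' ^ 169 := by
      rw [map_sub, map_pow, map_pow, ← hy', ← hz']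
      simp only [U]
      linear_combination (congrArg (· ^ 169) hy)
    rw [h2]
    exact Ideal.mul_mem_right _ _ (Ideal.mem_map_of_mem _ h)
  have hV : V - 1 ∈ p.map ι := by
    have h : X 0 * X 1 ^ 18 - X 2 ^ 11 ∈ p := by
      rw [hmem]; simp [toPoly, ← pow_mul, ← pow_add]
    have h2 : V - 1 = ι (X 0 * X 1 ^ 18 - X 2 ^ 11) * z' ^ 11 := by
      rw [map_sub, map_mul, map_pow, map_pow, ← hy', ← hz', ← hx]
      simp only [V]
      linear_combination (congrArg (· ^ 11) hz)
    rw [h2]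
    exact Ideal.mul_mem_right _ _ (Ideal.mem_map_of_mem _ h)
  rw [symbPow, Ideal.mem_comap, Ideal.map_pow, ← DFunLike.congr_fun hev g]
  change eval₂ _ _ (taylor g) ∈ _
  rw [eval₂_eq']
  refine sum_mem fun m hm => Ideal.mul_mem_left _ _ ?_
  have hdeg : r ≤ m 0 + m 1 := by
    by_contra h
    refine mem_support_iff.1 hm ((le_ord_iff r g).1 hg m ?_)
    rw [Finsupp.degree_eq_sum, Fin.sum_univ_two]
    omega
  rw [Fin.prod_univ_two]
  refine Ideal.pow_le_pow_right hdeg ?_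
  rw [pow_add]
  exact Ideal.mul_mem_mul (Ideal.pow_mem_pow hU _) (Ideal.pow_mem_pow hV _)

/-- Membership in symbolic powers is a vanishing order condition. -/
theorem mem_symbPow_iff_ord (r : ℕ) (g : MvPolynomial (Fin 3) K) :
    g ∈ symbPow (pIdeal K 5 103 169) r ↔ (r : ℕ∞) ≤ ord g := by
  refine ⟨fun hg => ?_, mem_symbPow_of_le_ord⟩
  obtain ⟨s, hs, hsg⟩ := (mem_symbPow_iff _ r g).1 hg
  have h := le_ord_of_mem_pow hsg
  have h0 : ord s = 0 := by
    rw [mem_pIdeal_iff_ord, not_le] at hs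
    exact Order.lt_one_iff.1 (by exact_mod_cast hs)
  rwa [ord_mul, h0, zero_add] at h

end Taylor

/-! ### The kernel of the parametrization -/

section Elimination

open Polynomial in
theorem exists_combination_eq_C {R : Type*} [CommRing R] [IsDomain R] [IsIntegrallyClosed R]
    [UniqueFactorizationMonoid R] {F H : R[X]} (hF : Irreducible F) (hdeg : F.natDegree ≠ 0)
    (hdvd : ¬ F ∣ H) : ∃ b : R, b ≠ 0 ∧ ∃ u v : R[X], F * u + H * v = Polynomial.C b := by
  classical
  let φ := algebraMap R (FractionRing R)
  have hφ : Function.Injective φ := IsFractionRing.injective R (FractionRing R)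
  have hprim : F.IsPrimitive := hF.isPrimitive hdeg
  have hirr : Irreducible (F.map φ) := by
    let := Classical.choice (inferInstance : Nonempty (NormalizedGCDMonoid R))
    exact hprim.irreducible_iff_irreducible_map_fraction_map.1 hF
  have hcop : IsCoprime (F.map φ) (H.map φ) := by
    rw [hirr.coprime_iff_not_dvd]
    intro h
    let := Classical.choice (inferInstance : Nonempty (NormalizedGCDMonoid R))
    exact hdvd (hprim.dvd_of_fraction_map_dvd_fraction_map h)
  refine ⟨F.resultant H, fun h => ?_, ?_⟩
  · have h2 : (F.map φ).resultant (H.map φ) = 0 := by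
      rw [natDegree_map_eq_of_injective hφ, natDegree_map_eq_of_injective hφ, resultant_map_map, h,
        map_zero]
    exact (resultant_eq_zero_iff.1 h2).2 hcop
  · obtain ⟨u, v, -, -, h⟩ := exists_mul_add_mul_eq_C_resultant F H le_rfl le_rfl (.inl hdeg)
    exact ⟨u, v, h⟩

end Elimination

section Kernel

variable {K : Type*} [Field K]

theorem weight_wt (m : Fin 3 →₀ ℕ) : Finsupp.weight (wt 5 103 169) m = wdeg m := by
  rw [Finsupp.weight_apply, Finsupp.sum_fintype _ _ (fun i => by simp), Fin.sum_univ_three]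
  simp [wt, wdeg]
  ring

theorem family_eq_zero_iff {d : ℕ} {g : MvPolynomial (Fin 3) K}
    (hg : g.IsWeightedHomogeneous (wt 5 103 169) d) : family K g = 0 ↔ cf d g = 0 := by
  refine ⟨fun h => by rw [cf_apply, h, Polynomial.coeff_zero], fun h => Polynomial.ext fun e => ?_⟩
  rw [Polynomial.coeff_zero]
  obtain rfl | hne := eq_or_ne e d
  · exact h
  change cf e g = 0
  rw [cf_eq_sum]
  refine Finset.sum_eq_zero fun m hm => ?_
  rw [Finset.mem_filter, mem_support_iff] at hm
  have := hg hm.1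
  rw [weight_wt] at this
  omega

theorem family_ne_zero {g : MvPolynomial (Fin 3) K} (hg : g ≠ 0) (h0 : ∀ m ∈ g.support, m 0 = 0) :
    family K g ≠ 0 := by
  intro h
  obtain ⟨m, hm⟩ := Finset.nonempty_of_ne_empty (mt support_eq_empty.1 hg)
  obtain ⟨m₀, hm₀, hmin⟩ := Finset.exists_min_image {n ∈ g.support | wdeg n = wdeg m}
    (fun n => 39 * n 1 + 64 * n 2) ⟨m, by simpa using hm⟩
  simp only [Finset.mem_filter] at hm₀ hmin
  have h1 : (cf (wdeg m) g).coeff (39 * m₀ 1 + 64 * m₀ 2) = 0 := by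
    rw [cf_apply, h, Polynomial.coeff_zero, Polynomial.coeff_zero]
  rw [cf_eq_sum, Polynomial.finsetSum_coeff, Finset.sum_eq_single_of_mem m₀ (by simpa using hm₀)] at h1
  · rw [Polynomial.coeff_C_mul, term, h0 _ hm₀.1, mul_zero, zero_add, mul_assoc,
      Polynomial.coeff_X_pow_mul', if_pos le_rfl, Nat.sub_self, Polynomial.coeff_zero_eq_eval_zero]
      at h1
    simp only [Polynomial.eval_mul, Polynomial.eval_pow, quad, quart, Polynomial.eval_neg,
      Polynomial.eval_add, Polynomial.eval_one, Polynomial.eval_X, Polynomial.eval_ofNat] at h1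
    refine mem_support_iff.1 hm₀.1 ((mul_eq_zero.1 h1).resolve_right ?_)
    simp
  · intro n hn hne
    simp only [Finset.mem_filter] at hn
    have hle := hmin n hn
    have h2 : 39 * m₀ 1 + 64 * m₀ 2 < 39 * n 1 + 64 * n 2 := by
      refine lt_of_le_of_ne hle fun heq => hne ?_
      have h3 := hn.2.trans hm₀.2.symm
      have h4 := h0 _ hn.1
      have h5 := h0 _ hm₀.1
      unfold wdeg at h3
      ext i
      fin_cases i <;> simp <;> omega
    rw [Polynomial.coeff_C_mul, Polynomial.X_pow_dvd_iff.1 (X_pow_dvd_term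
      (a := 39 * n 1 + 64 * n 2) (by omega)) _ h2, mul_zero]

/-- An irreducible element of the kernel of the parametrization generates it. -/
theorem dvd_of_family_eq_zero {f h : MvPolynomial (Fin 3) K} (hf : Irreducible f)
    (hf0 : family K f = 0) (hh : family K h = 0) : f ∣ h := by
  by_contra hdvd
  let e := finSuccEquiv K 2
  have hdeg : (e f).natDegree ≠ 0 := by
    intro h0
    rw [natDegree_finSuccEquiv] at h0
    exact family_ne_zero hf.ne_zero (fun m hm => by have := monomial_le_degreeOf 0 hm; omega) hf0
  obtain ⟨b, hb, u, v, huv⟩ := exists_combination_eq_C ((MulEquiv.irreducible_iff e).2 hf) hdeg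
    (H := e h) (fun hd => hdvd ((map_dvd_iff e).1 hd))
  have h1 : e.symm (.C b) = f * e.symm u + h * e.symm v := by
    rw [← huv, map_add, map_mul, map_mul, e.symm_apply_apply, e.symm_apply_apply]
  refine family_ne_zero (g := e.symm (.C b)) ?_ (fun m hm => ?_) ?_
  · simpa using hb
  · have h2 := monomial_le_degreeOf 0 hm
    rw [← natDegree_finSuccEquiv] at h2
    change m 0 ≤ (e (e.symm _)).natDegree at h2
    rw [e.apply_symm_apply, Polynomial.natDegree_C] at h2
    omega
  · rw [h1, map_add, map_mul, map_mul, hf0, hh, zero_mul, zero_mul, add_zero]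

theorem family_eq_zero_of_mem_gpiece [IsAlgClosed K] [CharZero K] {r d : ℕ}
    (hrd : 413 * d < 121849 * r) {g : MvPolynomial (Fin 3) K}
    (hg : g ∈ gpiece K 5 103 169 (symbPow (pIdeal K 5 103 169) r) d) : family K g = 0 := by
  by_contra h
  have := le_of_cf_ne_zero hg.1 (mt (family_eq_zero_iff hg.2).2 h)
  omega

/-- A cofactor of a nonzero weighted homogeneous product is weighted homogeneous. -/
theorem isWeightedHomogeneous_of_mul {w : Fin 3 → ℕ} {i n : ℕ} {f g : MvPolynomial (Fin 3) K}
    (hf : f.IsWeightedHomogeneous w i) (hfg : (f * g).IsWeightedHomogeneous w n)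
    (h0 : f * g ≠ 0) : i ≤ n ∧ g.IsWeightedHomogeneous w (n - i) := by
  let := weightedGradedAlgebra K w
  have h1 : (DirectSum.decompose (weightedHomogeneousSubmodule K w) (f * g) n : MvPolynomial _ K) =
      f * g := DirectSum.decompose_of_mem_same _ hfg
  have hle : i ≤ n := by
    by_contra h
    rw [DirectSum.coe_decompose_mul_of_left_mem_of_not_le _ hf h] at h1
    exact h0 h1.symm
  rw [DirectSum.coe_decompose_mul_of_left_mem_of_le _ hf hle] at h1
  refine ⟨hle, ?_⟩
  rw [← mul_left_cancel₀ (left_ne_zero_of_mul h0) h1]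
  exact (DirectSum.decompose (weightedHomogeneousSubmodule K w) g (n - i)).2

theorem ord_eq_seven [IsAlgClosed K] [CharZero K] {f : MvPolynomial (Fin 3) K} (hf : Irreducible f)
    (hmem : f ∈ gpiece K 5 103 169 (symbPow (pIdeal K 5 103 169) 7) 2065) : ord f = 7 := by
  have hf0 := family_eq_zero_of_mem_gpiece (by norm_num) hmem
  refine le_antisymm (not_lt.1 fun hlt => ?_) (by exact_mod_cast (mem_symbPow_iff_ord 7 f).1 hmem.1)
  have h8 : f ∈ symbPow (pIdeal K 5 103 169) (7 + 1) := by
    rw [mem_symbPow_iff_ord]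
    exact_mod_cast Order.add_one_le_of_lt hlt
  have hpd : (pderiv 0 f).IsWeightedHomogeneous (wt 5 103 169) 2060 := hmem.2.pderiv rfl
  have h1 : X 0 * pderiv 0 f ∈ gpiece K 5 103 169 (symbPow (pIdeal K 5 103 169) 7) 2065 :=
    ⟨Ideal.mul_mem_left _ _ (derivation_mem_symbPow (pderiv 0) _ h8),
      (isWeightedHomogeneous_X K _ 0).mul hpd⟩
  have h2 := family_eq_zero_of_mem_gpiece (by norm_num) h1
  obtain ⟨g, hg⟩ := dvd_of_family_eq_zero hf hf0
    ((mul_eq_zero.1 (map_mul (family K) _ _ ▸ h2)).resolve_left (by simp [family]))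
  have h3 : pderiv 0 f = 0 := by
    by_contra hne
    rw [hg] at hne hpd
    exact absurd (isWeightedHomogeneous_of_mul hmem.2 hpd hne).1 (by norm_num)
  refine family_ne_zero hf.ne_zero (fun m hm => ?_) hf0
  by_contra hm0
  have h4 := coeff_pderiv (i := 0) f (m - Finsupp.single 0 1)
  rw [h3, coeff_zero, tsub_add_cancel_of_le (by simpa using Nat.one_le_iff_ne_zero.2 hm0)] at h4
  refine mem_support_iff.1 hm ((mul_eq_zero.1 h4.symm).resolve_right ?_)
  exact Nat.cast_add_one_ne_zero _

theorem exists_eq_mul_of_family_eq_zero [IsAlgClosed K] [CharZero K] {f h : MvPolynomial (Fin 3) K}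
    {r d : ℕ} (hf : Irreducible f)
    (hmem : f ∈ gpiece K 5 103 169 (symbPow (pIdeal K 5 103 169) 7) 2065)
    (hh : h ∈ gpiece K 5 103 169 (symbPow (pIdeal K 5 103 169) (r + 7)) (d + 2065))
    (h0 : family K h = 0) :
    ∃ g ∈ gpiece K 5 103 169 (symbPow (pIdeal K 5 103 169) r) d, h = f * g := by
  obtain ⟨g, rfl⟩ := dvd_of_family_eq_zero hf
    (family_eq_zero_of_mem_gpiece (by norm_num) hmem) h0
  obtain rfl | hg0 := eq_or_ne g 0
  · exact ⟨0, zero_mem _, rfl⟩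
  refine ⟨g, ⟨?_, ?_⟩, rfl⟩
  · change g ∈ symbPow _ _
    have := (mem_symbPow_iff_ord _ _).1 hh.1
    rw [ord_mul, ord_eq_seven hf hmem, add_comm] at this
    rw [mem_symbPow_iff_ord]
    push_cast at this
    exact (ENat.add_le_add_iff_left (by decide)).1 this
  · simpa using (isWeightedHomogeneous_of_mul hmem.2 hh.2 (mul_ne_zero hf.ne_zero hg0)).2

end Kernel

/-! ### Counting dimensions -/

section Dimension

variable {K : Type*} [Field K]

variable (K) in
/-- The space of weighted homogeneous polynomials of degree `d`. -/
abbrev piece (d : ℕ) : Submodule K (MvPolynomial (Fin 3) K) :=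
  weightedHomogeneousSubmodule K (wt 5 103 169) d

variable (K) in
/-- The degree-`d` piece of the `r`-th symbolic power. -/
abbrev symbPiece (r d : ℕ) : Submodule K (MvPolynomial (Fin 3) K) :=
  gpiece K 5 103 169 (symbPow (pIdeal K 5 103 169) r) d

instance finiteDimensional_piece (d : ℕ) : FiniteDimensional K (piece K d) :=
  Module.Finite.iff_fg.2 (weightedHomogeneousSubmodule_fg _ _ (by intro i; fin_cases i <;> simp [wt]) d)

instance finiteDimensional_symbPiece (r d : ℕ) : FiniteDimensional K (symbPiece K r d) :=
  Submodule.finiteDimensional_of_le (inf_le_right : symbPiece K r d ≤ piece K d)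

theorem finrank_piece (d : ℕ) :
    Module.finrank K (piece K d) = Nat.card {m : Fin 3 →₀ ℕ // wdeg m = d} := by
  have h : piece K d = restrictSupport K {m | wdeg m = d} := by
    simp only [piece, weightedHomogeneousSubmodule_eq_finsupp_supported, weight_wt]
    rfl
  rw [h, Module.finrank_eq_nat_card_basis (basisRestrictSupport K _)]
  rfl

theorem finite_wdeg_eq (d : ℕ) : Finite {m : Fin 3 →₀ ℕ // wdeg m = d} := by
  have := Finsupp.finite_of_nat_weight_eq (wt 5 103 169)
    (by intro i; fin_cases i <;> simp [wt]) d
  simp only [weight_wt] at this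
  exact this.to_subtype

theorem card_add_le (d : ℕ) :
    Nat.card {m : Fin 3 →₀ ℕ // wdeg m = d} + 413 * (d / 17407) ≤
      Nat.card {m : Fin 3 →₀ ℕ // wdeg m = d + 2065} := by
  have := finite_wdeg_eq d
  have := finite_wdeg_eq (d + 2065)
  let k (i l : ℕ) : ℕ := 64 * (d + 2065 - 5 * i) % 103 + 103 * l
  let j (i l : ℕ) : ℕ := (d + 2065 - 5 * i - 169 * k i l) / 103
  have key (i : Fin 413) (l : Fin (d / 17407)) : 5 * i.1 + 103 * j i l + 169 * k i l = d + 2065 := by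
    have hi := i.2
    have hl := l.2
    simp only [j, k]
    omega
  let φ : {m : Fin 3 →₀ ℕ // wdeg m = d} ⊕ Fin 413 × Fin (d / 17407) →
      {m : Fin 3 →₀ ℕ // wdeg m = d + 2065} := Sum.elim
    (fun m => ⟨m.1 + Finsupp.single 0 413, by have := m.2; simp [wdeg] at this ⊢; omega⟩)
    (fun p => ⟨Finsupp.equivFunOnFinite.symm ![p.1, j p.1 p.2, k p.1 p.2], by
      simpa [wdeg] using key p.1 p.2⟩)
  have hφ : Function.Injective φ := by
    rintro (m | ⟨i, l⟩) (m' | ⟨i', l'⟩) h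
    · simpa [φ, Subtype.ext_iff] using h
    · have h0 := DFunLike.congr_fun (Subtype.ext_iff.1 h) 0
      have := i'.2
      simp [φ] at h0
      omega
    · have h0 := DFunLike.congr_fun (Subtype.ext_iff.1 h) 0
      have := i.2
      simp [φ] at h0
      omega
    · have h0 := DFunLike.congr_fun (Subtype.ext_iff.1 h) 0
      have h2 := DFunLike.congr_fun (Subtype.ext_iff.1 h) 2
      simp [φ, k] at h0 h2
      have h3 : i = i' := Fin.ext h0
      subst h3
      have h4 : l = l' := Fin.ext (by omega)
      rw [h4]
  have h := Nat.card_le_card_of_injective φ hφ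
  rwa [Nat.card_sum, Nat.card_prod, Nat.card_fin, Nat.card_fin] at h

theorem coeff_taylor {d e : ℕ} {g : MvPolynomial (Fin 3) K} (hg : g ∈ piece K d) (hne : e ≠ d)
    (n : Fin 2 →₀ ℕ) : (coeff n (taylor g)).coeff e = 0 := by
  have h (m : Fin 3 →₀ ℕ) (c : K) : taylor (monomial m c) = C (.C c * .X ^ wdeg m) *
      map Polynomial.C ((1 + X 0) ^ (2 * m 0 + 39 * m 1 + 64 * m 2) * (1 + X 1) ^ m 0) := by
    rw [taylor, aeval_monomial, Finsupp.prod_fintype _ _ (fun _ => pow_zero _), Fin.prod_univ_three]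
    simp only [Matrix.cons_val_zero, Matrix.cons_val_one, Matrix.cons_val]
    rw [show algebraMap K (MvPolynomial (Fin 2) (Polynomial K)) c = C (.C c) from rfl]
    simp only [wdeg, map_mul, map_pow, mul_pow, pow_add, pow_mul, map_add, map_one, map_X]
    ring
  rw [g.as_sum, map_sum, coeff_sum, Polynomial.finsetSum_coeff]
  refine Finset.sum_eq_zero fun m hm => ?_
  have hm' := hg (mem_support_iff.1 hm)
  rw [weight_wt] at hm'
  rw [h, coeff_C_mul, coeff_map, Polynomial.coeff_mul_C, Polynomial.coeff_C_mul,
    Polynomial.coeff_X_pow, if_neg (by omega), mul_zero, zero_mul]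

theorem two_mul_finrank_piece_le (r d : ℕ) :
    2 * Module.finrank K (piece K d) ≤ 2 * Module.finrank K (symbPiece K r d) + r * (r + 1) := by
  let ι := Σ i : Fin r, Fin (i.1 + 1)
  let ex (p : ι) : Fin 2 →₀ ℕ := Finsupp.equivFunOnFinite.symm ![p.2.1, p.1.1 - p.2.1]
  let ψ : MvPolynomial (Fin 3) K →ₗ[K] ι → K := LinearMap.pi fun p => Polynomial.lcoeff K d ∘ₗ
    (lcoeff (Polynomial K) (ex p)).restrictScalars K ∘ₗ (taylor (K := K)).toLinearMap
  have h1 := (ψ.domRestrict (piece K d)).finrank_range_add_finrank_ker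
  have h2 : (LinearMap.ker (ψ.domRestrict (piece K d))).map (piece K d).subtype ≤
      symbPiece K r d := by
    rintro _ ⟨⟨g, hg⟩, hψ, rfl⟩
    refine ⟨(mem_symbPow_iff_ord r g).2 ((le_ord_iff r g).2 fun m hm => ?_), hg⟩
    ext e
    rw [Polynomial.coeff_zero]
    obtain rfl | hne := eq_or_ne e d
    · rw [Finsupp.degree_eq_sum, Fin.sum_univ_two] at hm
      have h3 : ex ⟨⟨m 0 + m 1, hm⟩, ⟨m 0, by simp only; omega⟩⟩ = m := by
        ext i
        fin_cases i <;> simp [ex]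
      have h4 := congrFun hψ ⟨⟨m 0 + m 1, hm⟩, ⟨m 0, by simp only; omega⟩⟩
      change ((taylor g).coeff (ex _)).coeff e = 0 at h4
      rwa [h3] at h4
    · exact coeff_taylor hg hne m
  have h5 := Submodule.finrank_mono h2
  rw [Submodule.finrank_map_subtype_eq] at h5
  have h6 := Submodule.finrank_le (LinearMap.range (ψ.domRestrict (piece K d)))
  rw [Module.finrank_fintype_fun_eq_card, Fintype.card_sigma] at h6
  simp only [Fintype.card_fin] at h6
  rw [Fin.sum_univ_eq_sum_range (fun i => i + 1) r] at h6
  have h7 := Finset.sum_range_id_mul_two (r + 1)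
  rw [Finset.sum_range_succ', Nat.add_sub_cancel, add_zero, mul_comm (r + 1)] at h7
  omega

theorem finrank_symbPiece_add_le [IsAlgClosed K] [CharZero K] {f : MvPolynomial (Fin 3) K}
    (hf : Irreducible f) (hmem : f ∈ symbPiece K 7 2065) (r d : ℕ) :
    Module.finrank K (symbPiece K (r + 7) (d + 2065)) ≤ Module.finrank K (symbPiece K r d) +
      Module.finrank K ((symbPiece K (r + 7) (d + 2065)).map (cf (d + 2065))) := by
  let V := symbPiece K (r + 7) (d + 2065)
  let φ := (cf (K := K) (d + 2065)).domRestrict V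
  have h1 := φ.finrank_range_add_finrank_ker
  rw [LinearMap.range_domRestrict] at h1
  have h2 : (LinearMap.ker φ).map V.subtype ≤ (symbPiece K r d).map (LinearMap.mulLeft K f) := by
    rintro _ ⟨⟨h, hV⟩, hh, rfl⟩
    obtain ⟨g, hg, rfl⟩ := exists_eq_mul_of_family_eq_zero hf hmem hV
      ((family_eq_zero_iff hV.2).2 hh)
    exact ⟨g, hg, rfl⟩
  have h3 := (Submodule.finrank_mono h2).trans (Submodule.finrank_map_le _ _)
  rw [Submodule.finrank_map_subtype_eq] at h3
  change Module.finrank K V ≤ _ + Module.finrank K (V.map (cf (d + 2065)))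
  omega

theorem finrank_map_cf_le [IsAlgClosed K] [CharZero K] {r d : ℕ} (hrd : 121849 * r ≤ 413 * d) :
    17407 * Module.finrank K ((symbPiece K r d).map (cf d)) + 121849 * r ≤ 413 * d + 17407 := by
  let l := (413 * d - 121849 * r) / 17407
  have h : (symbPiece K r d).map (cf d) ≤ (Polynomial.degreeLT K (l + 1)).map
      (LinearMap.mulLeft K (.X ^ ((39 * d + 102) / 103) * septic K ^ r)) := by
    rintro _ ⟨g, hg, rfl⟩
    obtain ⟨q, hq, hdeg⟩ := exists_cf_eq hg.1 d
    by_cases h0 : cf d g = 0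
    · rw [h0]; exact zero_mem _
    · refine ⟨q, ?_, hq.symm⟩
      have := hdeg h0
      rw [SetLike.mem_coe, Polynomial.mem_degreeLT]
      refine Polynomial.degree_le_natDegree.trans_lt ?_
      simp only [l]
      norm_cast
      omega
  have h2 := (Submodule.finrank_mono h).trans (Submodule.finrank_map_le _ _)
  rw [(Polynomial.degreeLTEquiv K (l + 1)).finrank_eq, Module.finrank_fin_fun] at h2
  simp only [l] at h2
  omega

end Dimension

/-! ### Extremal elements of a Noetherian symbolic Rees algebra -/

section Extremal

variable {K : Type*} [Field K]

/-- If no element is extremal, finite generation forces a uniform gap. -/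
theorem exists_uniform_gap (hN : IsNoetherianRing (symbolicRees (pIdeal K 5 103 169)))
    (hgap : ∀ r d : ℕ, 1 ≤ r → ∀ h ∈ symbPow (pIdeal K 5 103 169) r, cf d h ≠ 0 →
      121849 * r < 413 * d) :
    ∃ q : ℕ, 1 ≤ q ∧ ∀ r d : ℕ, ∀ h ∈ symbPow (pIdeal K 5 103 169) r, cf d h ≠ 0 →
      q * (121849 * r) + r ≤ q * (413 * d) := by
  obtain ⟨G, hG, hgen⟩ := exists_finset_generators _ hN
  refine ⟨G.sup Prod.fst + 1, by omega, fun r => ?_⟩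
  induction r using Nat.strong_induction_on with
  | _ r ih =>
    intro d h hh h0
    obtain rfl | hr := Nat.eq_zero_or_pos r
    · simp
    obtain ⟨a, ha, rfl⟩ := hgen r hr h hh
    rw [map_sum] at h0
    obtain ⟨p, hp, h1⟩ := Finset.exists_ne_zero_of_sum_ne_zero h0
    rw [Finset.mem_filter] at hp
    rw [cf_apply, map_mul, Polynomial.coeff_mul] at h1
    obtain ⟨⟨d₁, d₂⟩, hd, h2⟩ := Finset.exists_ne_zero_of_sum_ne_zero h1
    rw [Finset.HasAntidiagonal.mem_antidiagonal] at hd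
    obtain ⟨hp1, hp2⟩ := hG p hp.1
    have h3 := ih (r - p.1) (by omega) d₁ (a p) (ha p hp.1 hp.2) (left_ne_zero_of_mul h2)
    have h4 := hgap p.1 d₂ hp1 p.2 hp2 (right_ne_zero_of_mul h2)
    have h5 : p.1 ≤ G.sup Prod.fst := Finset.le_sup (f := Prod.fst) hp.1
    obtain ⟨s, rfl⟩ := Nat.exists_eq_add_of_le hp.2
    rw [Nat.add_sub_cancel_left] at h3
    simp only at hd
    subst hd
    have h6 := Nat.mul_le_mul_left (G.sup Prod.fst + 1) (Nat.succ_le_of_lt h4)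
    rw [Nat.succ_eq_add_one] at h6
    linarith

/-- The numerical contradiction behind `exists_extremal`. -/
theorem false_of_dimension_estimates {N H : ℕ → ℕ} {q t e J : ℕ} (hq : 1 ≤ q)
    (ht : t = 4000000 * q) (he : e = 28 * (q * t) + t) (hJ : J = 118 * (q * t)) (h0 : H 0 ≤ N 0)
    (hN : ∀ k, 17407 * N k + 413 * (e + 2065 * k) ≤ 17407 * N (k + 1) + 413 * 17406)
    (hH : ∀ k < J, 17407 * H (k + 1) + 98 * (k + 1) ≤ 17407 * H k + 413 * e + 17407)
    (hH' : ∀ k < J, J ≤ k + t → H (k + 1) ≤ H k)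
    (hJN : 2 * N J ≤ 2 * H J + 7 * J * (7 * J + 1)) : False := by
  have htJ : t ≤ J := by nlinarith
  have step (k : ℕ) : k ≤ J → (852943 * k * (k - 1) - 14411974 * k : ℤ) ≤
      34814 * (N k - H k) := by
    induction k with
    | zero => intro; push_cast; omega
    | succ k ih =>
      intro hk
      have h1 := ih (by omega)
      have h2 := hN k
      have h3 := hH k (by omega)
      zify at h2 h3
      push_cast
      linarith
  have step' (i : ℕ) : i ≤ t → (852943 * (J - t + i) * (J - t + i - 1) - 14411974 * (J - t + i)
      + 826 * t * i : ℤ) ≤ 34814 * (N (J - t + i) - H (J - t + i)) := by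
    induction i with
    | zero =>
      intro
      have := step (J - t) (by omega)
      push_cast [htJ] at this
      simpa using this
    | succ i ih =>
      intro hi
      have h1 := ih (by omega)
      have h2 := hN (J - t + i)
      have h3 := hH' (J - t + i) (by omega) (by omega)
      have h4 : 413 * e = 98 * J + 413 * t := by rw [he, hJ]; ring
      have h5 : J - t + i < J := by omega
      zify [htJ] at h2 h3 h4 h5
      rw [← add_assoc]
      push_cast
      linarith
  have h := step' t le_rfl
  rw [Nat.sub_add_cancel htJ] at h
  simp only [sub_add_cancel] at h
  have h1 : (34814 * (N J - H J) : ℤ) ≤ 17407 * (7 * J * (7 * J + 1)) := by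
    zify at hJN
    linarith
  have h2 : (826 * t * t : ℤ) ≤ 15386766 * J := by linarith
  have h3 : 826 * t * t ≤ 15386766 * J := by exact_mod_cast h2
  rw [hJ, ht] at h3
  nlinarith [Nat.mul_le_mul hq hq]

/-- A Noetherian symbolic Rees algebra has an extremal element off the curve `f = 0`. -/
theorem exists_extremal [IsAlgClosed K] [CharZero K]
    (hN : IsNoetherianRing (symbolicRees (pIdeal K 5 103 169)))
    {f : MvPolynomial (Fin 3) K} (hf : Irreducible f) (hmem : f ∈ symbPiece K 7 2065) :
    ∃ r d : ℕ, 1 ≤ r ∧ 413 * d = 121849 * r ∧ ∃ h ∈ symbPow (pIdeal K 5 103 169) r, cf d h ≠ 0 := by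
  by_contra! hcon
  obtain ⟨q, hq, hgap⟩ := exists_uniform_gap hN fun r d hr h hh h0 =>
    lt_of_le_of_ne (le_of_cf_ne_zero hh h0) fun heq => h0 (hcon r d hr heq.symm h hh)
  obtain ⟨t, ht⟩ : ∃ t, t = 4000000 * q := ⟨_, rfl⟩
  obtain ⟨e, he⟩ : ∃ e, e = 28 * (q * t) + t := ⟨_, rfl⟩
  obtain ⟨J, hJ⟩ : ∃ J, J = 118 * (q * t) := ⟨_, rfl⟩
  have hd (k : ℕ) : e + 2065 * (k + 1) = e + 2065 * k + 2065 := by ring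
  have hr (k : ℕ) : 7 * (k + 1) = 7 * k + 7 := by ring
  refine false_of_dimension_estimates (N := fun k => Module.finrank K (piece K (e + 2065 * k)))
    (H := fun k => Module.finrank K (symbPiece K (7 * k) (e + 2065 * k))) hq ht he hJ
    (Submodule.finrank_mono inf_le_right) (fun k => ?_) (fun k hk => ?_) (fun k hk hkt => ?_)
    (two_mul_finrank_piece_le _ _)
  · have := card_add_le (e + 2065 * k)
    rw [← finrank_piece (K := K), ← finrank_piece (K := K)] at this
    rw [hd]
    omega
  · have h1 := finrank_symbPiece_add_le hf hmem (7 * k) (e + 2065 * k)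
    have h2 := finrank_map_cf_le (K := K) (r := 7 * k + 7) (d := e + 2065 * k + 2065) (by omega)
    rw [hd, hr]
    omega
  · have h1 := finrank_symbPiece_add_le hf hmem (7 * k) (e + 2065 * k)
    have h2 : (symbPiece K (7 * k + 7) (e + 2065 * k + 2065)).map (cf (e + 2065 * k + 2065)) = ⊥ := by
      rw [eq_bot_iff]
      rintro _ ⟨h, hh, rfl⟩
      by_contra h0
      have h3 := hgap _ _ h hh.1 h0
      have h4 : 413 * (e + 2065 * k + 2065) + 98 * (k + 1) = 121849 * (7 * k + 7) + (98 * J + 413 * t) := by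
        rw [he, hJ]; ring
      nlinarith
    rw [h2, finrank_bot, add_zero] at h1
    rw [hd, hr]
    exact h1

end Extremal

end SpaceMonomial

end

/-- for `K` algebraically closed of characteristic `0`, if
`R_s(𝔭_K(5,103,169))` is Noetherian then for the negative curve `f` spanning
`[𝔭^{(7)}]_{2065}` there is a nonzero `g2 ∈ [𝔭^{(59)}]_{17407}` with `f, g2` a
regular sequence; in particular `[𝔭^{(59)}]_{17407} ≠ 0`. -/
theorem statement16 (K : Type*) [Field K] [IsAlgClosed K] [CharZero K]
    (hNoeth : IsNoetherianRing (symbolicRees (pIdeal K 5 103 169)))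
    (f : MvPolynomial (Fin 3) K) (hirr : Irreducible f)
    (hspan : gpiece K 5 103 169 (symbPow (pIdeal K 5 103 169) 7) 2065 =
      Submodule.span K {f}) :
    (∃ g2 : MvPolynomial (Fin 3) K, g2 ≠ 0 ∧
      g2 ∈ gpiece K 5 103 169 (symbPow (pIdeal K 5 103 169) 59) 17407 ∧
      RingTheory.Sequence.IsRegular (MvPolynomial (Fin 3) K) [f, g2]) ∧
    gpiece K 5 103 169 (symbPow (pIdeal K 5 103 169) 59) 17407 ≠ ⊥ := by
  have hmem : f ∈ gpiece K 5 103 169 (symbPow (pIdeal K 5 103 169) 7) 2065 :=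
    hspan ▸ Submodule.mem_span_singleton_self f
  obtain ⟨r, d, hr, hrd, h, hh, h0⟩ := SpaceMonomial.exists_extremal hNoeth hirr hmem
  obtain ⟨n, rfl⟩ : 59 ∣ r := by omega
  obtain rfl : d = 17407 * n := by omega
  exact absurd (SpaceMonomial.cf_eq_zero_of_extremal (by omega) hh) h0
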